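/- Let p ≥ 2, let L > 0, and let f be a nonnegative log-concave function on [0, L]. Then for every continuously differentiable function u on [0, L] satisfying ∫₀^L f(x) |u(x)|^(p-2) u(x) dx = 0 and ∫₀^L f(x) |u(x)|^p dx > 0, one has ∫₀^L f(x) |u'(x)|^p dx ≥ (π_p / L)^p ∫₀^L f(x) |u(x)|^p dx. -/

import Mathlib

open MeasureTheory

/-- The generalized constant `π_p = 2π (p-1)^(1/p) / (p sin(π/p))`. -/
noncomputable def pi_p (p : ℝ) : ℝ :=
  2 * Real.pi * (p - 1) ^ (1 / p) / (p * Real.sin (Real.pi / p))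

open Set Filter Topology

/-- The Young inequality for conjugate exponents, cleared of denominators. -/
lemma mul_mul_le_rpow_add_rpow {p q a b : ℝ} (hpq : p.HolderConjugate q) (ha : 0 ≤ a)
    (hb : 0 ≤ b) : p * (a * b) ≤ b ^ p + (p - 1) * a ^ q := by
  have h := Real.young_inequality_of_nonneg hb ha hpq
  have hp := hpq.pos
  have hq := hpq.symm.pos
  have h2 : p / q = p - 1 := by
    have := hpq.inv_add_inv_eq_one
    field_simp at this ⊢
    linarith
  calc p * (a * b) = p * (b * a) := by ring
    _ ≤ p * (b ^ p / p + a ^ q / q) := by gcongr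
    _ = b ^ p + p / q * a ^ q := by field_simp
    _ = _ := by rw [h2]

lemma abs_rpow_sub_two_mul_self {p : ℝ} (a : ℝ) (hp : 1 < p) :
    |(|a| ^ (p - 2) * a)| = |a| ^ (p - 1) := by
  rcases eq_or_ne a 0 with rfl | ha
  · simp [Real.zero_rpow (by linarith : p - 1 ≠ 0)]
  · have h : 0 < |a| := abs_pos.mpr ha
    rw [abs_mul, abs_of_nonneg (by positivity), show p - 1 = (p - 2) + 1 by ring,
      Real.rpow_add_one h.ne']

lemma abs_rpow_tangent_le {p : ℝ} (hp : 1 < p) (a b : ℝ) :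
    |a| ^ p - p * b * (|a| ^ (p - 2) * a) ≤ |a - b| ^ p := by
  have hpq := Real.HolderConjugate.conjExponent hp
  have h := mul_mul_le_rpow_add_rpow hpq (Real.rpow_nonneg (abs_nonneg a) (p - 1))
    (abs_nonneg (a - b))
  have h1 : (|a| ^ (p - 1)) ^ (p.conjExponent) = |a| ^ p := by
    rw [← Real.rpow_mul (abs_nonneg a)]
    congr 1
    rw [Real.conjExponent]
    field_simp [(by linarith : p - 1 ≠ 0)]
  have h2 : |a| ^ (p - 2) * a * (a - b) ≤ |a| ^ (p - 1) * |a - b| := by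
    rw [← abs_rpow_sub_two_mul_self a hp, ← abs_mul]
    exact le_abs_self _
  have h3 : |a| ^ (p - 2) * a * a = |a| ^ p := by
    rcases eq_or_ne a 0 with rfl | ha
    · simp [Real.zero_rpow (by linarith : p ≠ 0)]
    · have h : 0 < |a| := abs_pos.mpr ha
      rw [mul_assoc, ← abs_mul_abs_self a, ← mul_assoc, ← Real.rpow_add_one h.ne',
        ← Real.rpow_add_one h.ne']
      congr 1; ring
  rw [h1] at h
  nlinarith

/-- A weighted integral against a nonnegative antitone weight is nonnegative as soon as all
primitives of the integrand are. -/
lemma integral_antitone_mul_nonneg {h g : ℝ → ℝ} {l : ℝ} (hanti : Antitone h)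
    (hpos : ∀ x ∈ Ioo 0 l, 0 ≤ h x) (hg : IntegrableOn g (Ioo 0 l))
    (hG : ∀ s ∈ Icc 0 l, 0 ≤ ∫ x in (0 : ℝ)..s, g x) :
    0 ≤ ∫ x in Ioo 0 l, h x * g x := by
  have hmeas : Measurable h := hanti.measurable
  have hint : Integrable (Function.uncurry fun x t : ℝ => (if t < h x then (1 : ℝ) else 0) * g x)
      ((volume.restrict (Ioo 0 l)).prod (volume.restrict (Ioc 0 (h 0)))) := by
    refine Integrable.bdd_mul (c := 1) (Integrable.comp_fst hg _) ?_ ?_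
    · refine (Measurable.ite ?_ measurable_const measurable_const).aestronglyMeasurable
      exact measurableSet_lt measurable_snd (hmeas.comp measurable_fst)
    · refine Eventually.of_forall fun z => ?_
      split_ifs <;> simp
  have hlayer : ∀ x ∈ Ioo 0 l, h x * g x =
      ∫ t in Ioc 0 (h 0), (if t < h x then (1 : ℝ) else 0) * g x := by
    intro x hx
    rw [integral_mul_const]
    congr 1
    have h1 : (fun t => if t < h x then (1 : ℝ) else 0) = (Iio (h x)).indicator 1 := by
      ext t; simp [indicator]
    have h2 : Ioc 0 (h 0) ∩ Iio (h x) = Ioo 0 (h x) := by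
      ext t
      have := hanti hx.1.le
      simp only [mem_inter_iff, mem_Ioc, mem_Iio, mem_Ioo]
      constructor
      · rintro ⟨⟨a, b⟩, c⟩; exact ⟨a, c⟩
      · rintro ⟨a, c⟩; exact ⟨⟨a, by linarith⟩, c⟩
    rw [h1, setIntegral_indicator measurableSet_Iio, h2]
    simp [hpos x hx]
  rw [setIntegral_congr_fun measurableSet_Ioo hlayer, integral_integral_swap hint]
  refine integral_nonneg fun t => ?_
  have hset : MeasurableSet {x | t < h x} := measurableSet_lt measurable_const hmeas
  have h1 : (fun x => (if t < h x then (1 : ℝ) else 0) * g x) = {x | t < h x}.indicator g := by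
    ext x; simp [indicator]
  simp only [Pi.zero_apply]
  rw [h1, setIntegral_indicator hset]
  set E := Ioo 0 l ∩ {x | t < h x} with hE
  rcases E.eq_empty_or_nonempty with h0 | hne
  · simp [h0]
  have hbdd : BddAbove E := ⟨l, fun x hx => hx.1.2.le⟩
  have hs0 : 0 ≤ sSup E := by
    obtain ⟨x, hx⟩ := hne
    exact hx.1.1.le.trans (le_csSup hbdd hx)
  have hsl : sSup E ≤ l := csSup_le hne fun x hx => hx.1.2.le
  have hsub1 : Ioo 0 (sSup E) ⊆ E := by
    intro x hx
    obtain ⟨y, hy, hxy⟩ := exists_lt_of_lt_csSup hne hx.2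
    exact ⟨⟨hx.1, hxy.trans hy.1.2⟩, lt_of_lt_of_le hy.2 (hanti hxy.le)⟩
  have hsub2 : E ⊆ Ioc 0 (sSup E) := fun x hx => ⟨hx.1.1, le_csSup hbdd hx⟩
  have hae : E =ᵐ[volume] Ioc 0 (sSup E) :=
    hsub2.eventuallyLE.antisymm (Ioo_ae_eq_Ioc.symm.le.trans hsub1.eventuallyLE)
  rw [setIntegral_congr_set hae, ← intervalIntegral.integral_of_le hs0]
  exact hG _ ⟨hs0, hsl⟩

/-- A global decreasing solution of the autonomous equation with velocity field `-D`. -/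
lemma exists_decreasing_solution {D : ℝ → ℝ} (hD : Continuous D) {a b : ℝ} (ha : 0 < a)
    (hDa : ∀ s, a ≤ D s) (hDb : ∀ s, D s ≤ b) (R : ℝ) :
    ∃ w : ℝ → ℝ, w 0 = R ∧ w (∫ s in (0 : ℝ)..R, (D s)⁻¹) = 0 ∧
      ∀ x, HasDerivAt w (-D (w x)) x := by
  have hpos : ∀ s, 0 < D s := fun s => ha.trans_le (hDa s)
  have hcont : Continuous fun s => (D s)⁻¹ := hD.inv₀ fun s => (hpos s).ne'
  set X : ℝ → ℝ := fun r => ∫ s in r..R, (D s)⁻¹ with hX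
  have hder : ∀ r, HasDerivAt X (-(D r)⁻¹) r := fun r =>
    intervalIntegral.integral_hasDerivAt_left (hcont.intervalIntegrable _ _)
      (hcont.stronglyMeasurableAtFilter _ _) hcont.continuousAt
  set Y : ℝ → ℝ := fun r => -X r with hY
  have hderY : ∀ r, HasDerivAt Y (D r)⁻¹ r := fun r => by simpa using (hder r).fun_neg
  have hYmono : StrictMono Y := strictMono_of_deriv_pos fun r => by
    rw [(hderY r).deriv]; exact inv_pos.mpr (hpos r)
  have hYcont : Continuous Y := continuous_iff_continuousAt.mpr fun r => (hderY r).continuousAt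
  have hb : 0 < b := (hpos 0).trans_le (hDb 0)
  have hZmono : Monotone fun r => Y r - b⁻¹ * r := by
    have hd : ∀ r, HasDerivAt (fun r => Y r - b⁻¹ * r) ((D r)⁻¹ - b⁻¹) r := fun r => by
      simpa using (hderY r).fun_sub ((hasDerivAt_id r).const_mul b⁻¹)
    refine monotone_of_deriv_nonneg (fun r => (hd r).differentiableAt) fun r => ?_
    rw [(hd r).deriv, sub_nonneg]
    exact inv_anti₀ (hpos r) (hDb r)
  have htop : Tendsto Y atTop atTop := by
    have h1 : Tendsto (fun r : ℝ => b⁻¹ * r + (Y 0 - b⁻¹ * 0)) atTop atTop :=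
      tendsto_atTop_add_const_right _ _ (tendsto_id.const_mul_atTop (inv_pos.mpr hb))
    refine tendsto_atTop_mono' _ ?_ h1
    filter_upwards [eventually_ge_atTop 0] with r hr
    have := hZmono hr
    simp only at this
    linarith
  have hbot : Tendsto Y atBot atBot := by
    have h1 : Tendsto (fun r : ℝ => b⁻¹ * r + (Y 0 - b⁻¹ * 0)) atBot atBot :=
      tendsto_atBot_add_const_right _ _ (tendsto_id.const_mul_atBot (inv_pos.mpr hb))
    refine tendsto_atBot_mono' _ ?_ h1
    filter_upwards [eventually_le_atBot 0] with r hr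
    have := hZmono hr
    simp only at this
    linarith
  have hsurj := hYcont.surjective htop hbot
  set e := hYmono.orderIsoOfSurjective Y hsurj with he
  have heY : ∀ r, e r = Y r := fun r => rfl
  have hYe : ∀ y, Y (e.symm y) = y := fun y => e.apply_symm_apply y
  have hsymm : ∀ y, HasDerivAt e.symm (D (e.symm y)) y := fun y => by
    have := HasDerivAt.of_local_left_inverse (f := Y) (g := e.symm) (a := y)
      e.symm.continuous.continuousAt (hderY _) (inv_pos.mpr (hpos _)).ne'
      (Eventually.of_forall hYe)
    simpa using this
  refine ⟨fun x => e.symm (-x), ?_, ?_, fun x => ?_⟩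
  · rw [OrderIso.symm_apply_eq, heY]; simp [hY, hX]
  · rw [OrderIso.symm_apply_eq, heY]
  · simpa [Function.comp_def] using (hsymm (-x)).comp x (hasDerivAt_neg x)

/-- The speed of the Riccati comparison flow for the exponential weight `exp (-c x)`,
truncated from below to stay positive. -/
noncomputable def riccatiSpeed (p lam c r : ℝ) : ℝ :=
  max (lam + (p - 1) * r ^ p.conjExponent - c * r) (lam / 2)

lemma continuous_riccatiSpeed {p : ℝ} (hp : 1 < p) (lam : ℝ) :
    Continuous fun z : ℝ × ℝ => riccatiSpeed p lam z.1 z.2 := by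
  have hq : 0 ≤ p.conjExponent := (Real.HolderConjugate.conjExponent hp).symm.nonneg
  unfold riccatiSpeed
  have := Real.continuous_rpow_const hq
  fun_prop

/-- The time the Riccati comparison flow needs to descend from `R` to `0`. -/
noncomputable def riccatiTime (p lam R c : ℝ) : ℝ :=
  ∫ r in (0 : ℝ)..R, (riccatiSpeed p lam c r)⁻¹

lemma exists_riccati_supersolution {p lam R : ℝ} (hp : 1 < p) (hlam : 0 < lam) (hR : 0 ≤ R)
    (c : ℝ) :
    ∃ w w' : ℝ → ℝ, (∀ x, HasDerivAt w (w' x) x) ∧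
      (∀ x ∈ Icc 0 (riccatiTime p lam R c), 0 ≤ w x) ∧
      ∀ x ∈ Icc 0 (riccatiTime p lam R c),
        w' x ≤ c * w x - lam - (p - 1) * w x ^ p.conjExponent := by
  have hcont : Continuous (riccatiSpeed p lam c) :=
    (continuous_riccatiSpeed hp lam).comp (Continuous.prodMk_right c)
  set D : ℝ → ℝ := IccExtend hR ((Icc 0 R).domRestrict (riccatiSpeed p lam c)) with hD
  have hDc : Continuous D := hcont.continuousOn.domRestrict.Icc_extend'
  have hDeq : ∀ s ∈ Icc 0 R, D s = riccatiSpeed p lam c s := fun s hs =>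
    IccExtend_of_mem hR _ hs
  obtain ⟨b, hb⟩ := (isCompact_Icc (a := (0 : ℝ)) (b := R)).bddAbove_image hcont.continuousOn
  have hDb : ∀ s, D s ≤ b := fun s => hb (mem_image_of_mem _ (projIcc 0 R hR s).2)
  have hDa : ∀ s, lam / 2 ≤ D s := fun s => le_max_right _ _
  obtain ⟨w, hw0, hwT, hw⟩ := exists_decreasing_solution hDc (half_pos hlam) hDa hDb R
  have hT : ∫ s in (0 : ℝ)..R, (D s)⁻¹ = riccatiTime p lam R c :=
    intervalIntegral.integral_congr fun s hs => by
      rw [uIcc_of_le hR] at hs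
      simp only [hDeq s hs]
  rw [hT] at hwT
  have hanti : Antitone w := antitone_of_deriv_nonpos (fun x => (hw x).differentiableAt)
    fun x => by rw [(hw x).deriv]; linarith [hDa (w x)]
  have hwR : ∀ x ∈ Icc 0 (riccatiTime p lam R c), w x ∈ Icc 0 R := fun x hx =>
    ⟨hwT ▸ hanti hx.2, hw0 ▸ hanti hx.1⟩
  refine ⟨w, fun x => -D (w x), hw, fun x hx => (hwR x hx).1, fun x hx => ?_⟩
  simp only [hDeq _ (hwR x hx)]
  have := le_max_left (lam + (p - 1) * w x ^ p.conjExponent - c * w x) (lam / 2)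
  rw [riccatiSpeed]
  linarith

/-- The mixed Dirichlet-Neumann Wirtinger inequality for an exponential weight, on all initial
segments. -/
lemma integral_exp_weight_nonneg {p lam R c l : ℝ} (hp : 1 < p) (hlam : 0 < lam)
    (hR : 0 ≤ R) (hl : l ≤ riccatiTime p lam R c) {v v' : ℝ → ℝ}
    (hv : ContinuousOn v (Icc 0 l)) (hv' : ContinuousOn v' (Icc 0 l))
    (hd : ∀ x ∈ Ioo 0 l, HasDerivAt v (v' x) x) (hv0 : v 0 = 0) {s : ℝ} (hs : s ∈ Icc 0 l) :
    0 ≤ ∫ x in (0 : ℝ)..s, Real.exp (-(c * x)) * (|v' x| ^ p - lam * |v x| ^ p) := by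
  obtain ⟨w, w', hw, hw0, hwle⟩ := exists_riccati_supersolution hp hlam hR c
  have hpq := Real.HolderConjugate.conjExponent hp
  have hp0 : 0 ≤ p := by linarith
  set P : ℝ → ℝ := fun x => Real.exp (-(c * x)) * w x * |v x| ^ p with hP
  have hwc : Continuous w := continuous_iff_continuousAt.mpr fun x => (hw x).continuousAt
  have hsub : Icc 0 s ⊆ Icc 0 l := Icc_subset_Icc_right hs.2
  have hPc : ContinuousOn P (Icc 0 s) := by
    refine ContinuousOn.mul (by fun_prop) ?_
    exact (hv.mono hsub).abs.rpow_const fun x _ => Or.inr hp0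
  have hgc : ContinuousOn (fun x => Real.exp (-(c * x)) * (|v' x| ^ p - lam * |v x| ^ p))
      (Icc 0 s) := by
    refine ContinuousOn.mul (by fun_prop) (ContinuousOn.sub ?_ (ContinuousOn.mul (by fun_prop) ?_))
    · exact (hv'.mono hsub).abs.rpow_const fun x _ => Or.inr hp0
    · exact (hv.mono hsub).abs.rpow_const fun x _ => Or.inr hp0
  have hexp : ∀ x, HasDerivAt (fun x => Real.exp (-(c * x))) (Real.exp (-(c * x)) * -c) x :=
    fun x => by simpa using (((hasDerivAt_id x).const_mul c).fun_neg).exp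
  have key := intervalIntegral.sub_le_integral_of_hasDeriv_right_of_le (g := P)
    (g' := fun x => (Real.exp (-(c * x)) * -c * w x + Real.exp (-(c * x)) * w' x) * |v x| ^ p +
      Real.exp (-(c * x)) * w x * (p * |v x| ^ (p - 2) * v x * v' x))
    (φ := fun x => Real.exp (-(c * x)) * (|v' x| ^ p - lam * |v x| ^ p)) hs.1 hPc
    (fun x hx => by
      have hx' : x ∈ Ioo 0 l := ⟨hx.1, hx.2.trans_le hs.2⟩
      exact ((((hexp x).fun_mul (hw x)).fun_mul
        ((hasDerivAt_abs_rpow (v x) hp).comp x (hd x hx'))).hasDerivWithinAt))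
    hgc.integrableOn_Icc ?_
  · refine le_trans ?_ key
    have h1 : P 0 = 0 := by simp [hP, hv0, Real.zero_rpow (by linarith : p ≠ 0)]
    rw [h1, sub_zero]
    have := hw0 s ⟨hs.1, hs.2.trans hl⟩
    positivity
  · intro x hx
    have hxT : x ∈ Icc 0 (riccatiTime p lam R c) := ⟨hx.1.le, (hx.2.le.trans hs.2).trans hl⟩
    have hwx := hw0 x hxT
    have h1 := mul_mul_le_rpow_add_rpow hpq
      (mul_nonneg hwx (Real.rpow_nonneg (abs_nonneg (v x)) (p - 1))) (abs_nonneg (v' x))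
    have h2 : (w x * |v x| ^ (p - 1)) ^ p.conjExponent = w x ^ p.conjExponent * |v x| ^ p := by
      rw [Real.mul_rpow hwx (by positivity), ← Real.rpow_mul (abs_nonneg _)]
      congr 2
      rw [Real.conjExponent]
      field_simp [(by linarith : p - 1 ≠ 0)]
    have h3 : |v x| ^ (p - 2) * v x * v' x ≤ |v x| ^ (p - 1) * |v' x| := by
      rw [← abs_rpow_sub_two_mul_self (v x) hp, ← abs_mul]
      exact le_abs_self _
    have h4 : w x * p * (|v x| ^ (p - 2) * v x * v' x) ≤ w x * p * (|v x| ^ (p - 1) * |v' x|) := by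
      gcongr
    have h5 := mul_le_mul_of_nonneg_right (hwle x hxT) (by positivity : 0 ≤ |v x| ^ p)
    rw [h2] at h1
    have h6 : (-c * w x + w' x) * |v x| ^ p + w x * p * (|v x| ^ (p - 2) * v x * v' x) ≤
        |v' x| ^ p - lam * |v x| ^ p := by nlinarith
    calc _ = Real.exp (-(c * x)) *
        ((-c * w x + w' x) * |v x| ^ p + w x * p * (|v x| ^ (p - 2) * v x * v' x)) := by ring
      _ ≤ _ := by gcongr

/-- The mixed Dirichlet-Neumann Wirtinger inequality for a weight decreasing at least as fast as
`exp (-c x)`. -/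
lemma integral_decreasing_weight_nonneg {p lam R c l B : ℝ} (hp : 1 < p) (hlam : 0 < lam)
    (hR : 0 ≤ R) (hl0 : 0 ≤ l) (hl : l ≤ riccatiTime p lam R c) {k v v' : ℝ → ℝ}
    (hk : AntitoneOn (fun x => k x * Real.exp (c * x)) (Ioo 0 l))
    (hk0 : ∀ x ∈ Ioo 0 l, 0 ≤ k x) (hkB : ∀ x ∈ Ioo 0 l, k x ≤ B)
    (hv : ContinuousOn v (Icc 0 l)) (hv' : ContinuousOn v' (Icc 0 l))
    (hd : ∀ x ∈ Ioo 0 l, HasDerivAt v (v' x) x) (hv0 : v 0 = 0) :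
    0 ≤ ∫ x in (0 : ℝ)..l, k x * (|v' x| ^ p - lam * |v x| ^ p) := by
  have hbelow : BddBelow ((fun x => k x * Real.exp (c * x)) '' Ioo 0 l) := by
    refine ⟨0, ?_⟩
    rintro _ ⟨x, hx, rfl⟩
    exact mul_nonneg (hk0 x hx) (Real.exp_pos _).le
  have habove : BddAbove ((fun x => k x * Real.exp (c * x)) '' Ioo 0 l) := by
    refine ⟨B * Real.exp (|c| * l), ?_⟩
    rintro _ ⟨x, hx, rfl⟩
    have h1 : c * x ≤ |c| * l := mul_le_mul (le_abs_self c) hx.2.le hx.1.le (abs_nonneg c)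
    have h2 := (hk0 x hx).trans (hkB x hx)
    exact mul_le_mul (hkB x hx) (Real.exp_le_exp.mpr h1) (Real.exp_pos _).le h2
  obtain ⟨h, hanti, hEq⟩ := hk.exists_antitone_extension hbelow habove
  have hp0 : 0 ≤ p := by linarith
  have hgc : ContinuousOn (fun x => Real.exp (-(c * x)) * (|v' x| ^ p - lam * |v x| ^ p))
      (Icc 0 l) := by
    refine ContinuousOn.mul (by fun_prop) (ContinuousOn.sub ?_ (ContinuousOn.mul (by fun_prop) ?_))
    · exact hv'.abs.rpow_const fun x _ => Or.inr hp0
    · exact hv.abs.rpow_const fun x _ => Or.inr hp0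
  have key := integral_antitone_mul_nonneg hanti
    (fun x hx => by rw [← hEq hx]; exact mul_nonneg (hk0 x hx) (Real.exp_pos _).le)
    (hgc.integrableOn_Icc.mono_set Ioo_subset_Icc_self)
    (fun s hs => integral_exp_weight_nonneg hp hlam hR hl hv hv' hd hv0 hs)
  rw [intervalIntegral.integral_of_le hl0, integral_Ioc_eq_integral_Ioo]
  refine key.trans_eq (setIntegral_congr_fun measurableSet_Ioo fun x hx => ?_)
  simp only [← hEq hx, Real.exp_neg]
  field_simp

lemma riccatiSpeed_pos {p lam : ℝ} (hlam : 0 < lam) (c r : ℝ) : 0 < riccatiSpeed p lam c r :=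
  (half_pos hlam).trans_le (le_max_right _ _)

lemma continuous_inv_riccatiSpeed {p lam : ℝ} (hp : 1 < p) (hlam : 0 < lam) :
    Continuous fun z : ℝ × ℝ => (riccatiSpeed p lam z.1 z.2)⁻¹ :=
  (continuous_riccatiSpeed hp lam).inv₀ fun _ => (riccatiSpeed_pos hlam _ _).ne'

lemma continuous_riccatiTime {p lam : ℝ} (hp : 1 < p) (hlam : 0 < lam) (R : ℝ) :
    Continuous (riccatiTime p lam R) :=
  intervalIntegral.continuous_parametric_intervalIntegral_of_continuous'
    (continuous_inv_riccatiSpeed hp hlam) 0 R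

lemma intervalIntegrable_inv_riccatiSpeed {p lam : ℝ} (hp : 1 < p) (hlam : 0 < lam) (c a b : ℝ) :
    IntervalIntegrable (fun r => (riccatiSpeed p lam c r)⁻¹) volume a b :=
  ((continuous_inv_riccatiSpeed hp hlam).comp (Continuous.prodMk_right c)).intervalIntegrable _ _

lemma riccatiTime_nonneg {p lam R : ℝ} (hlam : 0 < lam) (hR : 0 ≤ R) (c : ℝ) :
    0 ≤ riccatiTime p lam R c :=
  intervalIntegral.integral_nonneg hR fun _ _ => (inv_pos.mpr (riccatiSpeed_pos hlam _ _)).le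

lemma monotone_riccatiTime {p lam R : ℝ} (hp : 1 < p) (hlam : 0 < lam) (hR : 0 ≤ R) :
    Monotone (riccatiTime p lam R) := by
  intro c d hcd
  refine intervalIntegral.integral_mono_on hR (intervalIntegrable_inv_riccatiSpeed hp hlam _ _ _)
    (intervalIntegrable_inv_riccatiSpeed hp hlam _ _ _) fun r hr => ?_
  refine inv_anti₀ (riccatiSpeed_pos hlam _ _) (max_le_max ?_ le_rfl)
  have := mul_le_mul_of_nonneg_right hcd hr.1
  linarith

lemma tendsto_riccatiTime_atTop {p lam R : ℝ} (hp : 1 < p) (hlam : 0 < lam) (hR : 0 ≤ R) :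
    Tendsto (fun c => riccatiTime p lam R (-c)) atTop (𝓝 0) := by
  have h0 : (0 : ℝ) = ∫ r in (0 : ℝ)..R, (0 : ℝ) := by simp
  rw [h0]
  refine intervalIntegral.tendsto_integral_filter_of_dominated_convergence (fun _ => (lam / 2)⁻¹)
    ?_ ?_ (by simp) ?_
  · exact Eventually.of_forall fun c =>
      ((continuous_inv_riccatiSpeed hp hlam).comp
        (Continuous.prodMk_right (-c))).aestronglyMeasurable
  · refine Eventually.of_forall fun c => Eventually.of_forall fun r _ => ?_
    rw [Real.norm_of_nonneg (inv_pos.mpr (riccatiSpeed_pos hlam _ _)).le]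
    exact inv_anti₀ (half_pos hlam) (le_max_right _ _)
  · refine Eventually.of_forall fun r hr => ?_
    rw [uIoc_of_le hR] at hr
    refine Tendsto.inv_tendsto_atTop ?_
    have h1 : Tendsto (fun c : ℝ => c * r + (lam + (p - 1) * r ^ p.conjExponent)) atTop atTop :=
      tendsto_atTop_add_const_right _ _ (tendsto_id.atTop_mul_const hr.1)
    refine tendsto_atTop_mono (fun c => ?_) h1
    refine le_trans ?_ (le_max_left _ _)
    linarith

lemma two_mul_inv_le_riccatiSpeed {p lam r : ℝ} (hp : 1 < p) (hlam : 0 < lam) (hr : 0 ≤ r)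
    (c : ℝ) : 2 * (lam + (p - 1) * r ^ p.conjExponent)⁻¹ ≤
      (riccatiSpeed p lam c r)⁻¹ + (riccatiSpeed p lam (-c) r)⁻¹ := by
  set A := lam + (p - 1) * r ^ p.conjExponent with hA
  have hAl : lam ≤ A := by
    have : 0 ≤ (p - 1) * r ^ p.conjExponent := mul_nonneg (by linarith) (Real.rpow_nonneg hr _)
    linarith
  have hA0 : 0 < A := hlam.trans_le hAl
  have hhalf : 2 * A⁻¹ ≤ (lam / 2)⁻¹ := by
    rw [inv_div, div_eq_mul_inv]
    gcongr
  have hpos := fun c => inv_pos.mpr (riccatiSpeed_pos (p := p) hlam c r)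
  rcases le_total (A - c * r) (lam / 2) with h1 | h1
  · have : riccatiSpeed p lam c r = lam / 2 := max_eq_right h1
    rw [this]
    linarith [hpos (-c)]
  rcases le_total (A - -c * r) (lam / 2) with h2 | h2
  · have : riccatiSpeed p lam (-c) r = lam / 2 := max_eq_right h2
    rw [this]
    linarith [hpos c]
  have e1 : riccatiSpeed p lam c r = A - c * r := max_eq_left h1
  have e2 : riccatiSpeed p lam (-c) r = A - -c * r := max_eq_left h2
  have p1 : 0 < A - c * r := by linarith
  have p2 : 0 < A + c * r := by linarith
  rw [e1, e2, neg_mul, sub_neg_eq_add]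
  have : (A - c * r)⁻¹ + (A + c * r)⁻¹ - 2 * A⁻¹ =
      2 * (c * r) ^ 2 / (A * (A - c * r) * (A + c * r)) := by
    field_simp
    ring
  have h3 : 0 ≤ 2 * (c * r) ^ 2 / (A * (A - c * r) * (A + c * r)) := by positivity
  linarith

lemma two_mul_integral_le_riccatiTime {p lam R : ℝ} (hp : 1 < p) (hlam : 0 < lam) (hR : 0 ≤ R)
    (c : ℝ) : 2 * ∫ r in (0 : ℝ)..R, (lam + (p - 1) * r ^ p.conjExponent)⁻¹ ≤
      riccatiTime p lam R c + riccatiTime p lam R (-c) := by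
  have hq : 0 ≤ p.conjExponent := (Real.HolderConjugate.conjExponent hp).symm.nonneg
  rw [riccatiTime, riccatiTime, ← intervalIntegral.integral_add
    (intervalIntegrable_inv_riccatiSpeed hp hlam _ _ _)
    (intervalIntegrable_inv_riccatiSpeed hp hlam _ _ _), ← intervalIntegral.integral_const_mul]
  refine intervalIntegral.integral_mono_on hR ?_
    ((intervalIntegrable_inv_riccatiSpeed hp hlam _ _ _).add
      (intervalIntegrable_inv_riccatiSpeed hp hlam _ _ _))
    fun r hr => two_mul_inv_le_riccatiSpeed hp hlam hr.1 c
  refine ContinuousOn.intervalIntegrable ?_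
  have hc := Real.continuous_rpow_const hq
  refine ContinuousOn.mul (by fun_prop) (ContinuousOn.inv₀ (by fun_prop) fun r hr => ?_)
  rw [uIcc_of_le hR] at hr
  have : 0 ≤ (p - 1) * r ^ p.conjExponent := mul_nonneg (by linarith) (Real.rpow_nonneg hr.1 _)
  positivity

/-- Unimodality after every exponential tilt yields a point `τ c` at which the tilt by `c`
changes from increasing to decreasing. -/
lemma exists_tilt_peak {f τ : ℝ → ℝ} {L : ℝ} (hf : ∀ x ∈ Icc 0 L, 0 ≤ f x)
    (hquasi : ∀ c, ∀ x ∈ Icc 0 L, ∀ y ∈ Icc 0 L, ∀ z ∈ Icc x y,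
      min (f x * Real.exp (c * x)) (f y * Real.exp (c * y)) ≤ f z * Real.exp (c * z))
    (hpos : ∃ y ∈ Ioc 0 L, 0 < f y)
    (hτ : Continuous τ) (hτanti : Antitone τ) (hτ0 : ∀ c, 0 ≤ τ c)
    (hτtop : Tendsto τ atTop (𝓝 0)) (hτL : ∃ c, L < τ c) :
    ∃ c, τ c ≤ L ∧ MonotoneOn (fun x => f x * Real.exp (c * x)) (Ioo 0 (τ c)) ∧
      AntitoneOn (fun x => f x * Real.exp (c * x)) (Ioo (τ c) L) := by
  set S : Set ℝ := {c | ∃ x y, τ c ≤ x ∧ x < y ∧ y ≤ L ∧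
    f x * Real.exp (c * x) < f y * Real.exp (c * y)} with hS
  have hSlt : ∀ c ∈ S, τ c < L := by
    rintro c ⟨x, y, h1, h2, h3, -⟩; linarith
  have hne : S.Nonempty := by
    obtain ⟨y, hy, hfy⟩ := hpos
    have h1 : Tendsto (fun c : ℝ => Real.exp (c * (y / 2))) atTop atTop :=
      Real.tendsto_exp_atTop.comp (tendsto_id.atTop_mul_const (half_pos hy.1))
    obtain ⟨c, hc1, hc2⟩ := ((hτtop.eventually (gt_mem_nhds (half_pos hy.1))).and
      (h1.eventually (eventually_gt_atTop (f (y / 2) / f y)))).exists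
    refine ⟨c, y / 2, y, hc1.le, by linarith [hy.1], hy.2, ?_⟩
    have h2 : Real.exp (c * y) = Real.exp (c * (y / 2)) * Real.exp (c * (y / 2)) := by
      rw [← Real.exp_add]; ring_nf
    rw [div_lt_iff₀ hfy] at hc2
    rw [h2, ← mul_assoc]
    have := Real.exp_pos (c * (y / 2))
    nlinarith
  obtain ⟨c₀, hc₀⟩ := hτL
  have hbdd : BddBelow S := ⟨c₀, fun c hc => by
    by_contra! h
    linarith [hτanti h.le, hSlt c hc]⟩
  set d := sInf S with hd
  have hup : ∀ c, d < c → c ∈ S := by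
    intro c hc
    obtain ⟨b, ⟨x, y, h1, h2, h3, h4⟩, hbc⟩ := exists_lt_of_csInf_lt hne hc
    refine ⟨x, y, (hτanti hbc.le).trans h1, h2, h3, ?_⟩
    have e : ∀ t, Real.exp (c * t) = Real.exp (b * t) * Real.exp ((c - b) * t) := fun t => by
      rw [← Real.exp_add]; ring_nf
    rw [e x, e y, ← mul_assoc, ← mul_assoc]
    have hx0 : 0 ≤ x := (hτ0 b).trans h1
    have hfx : 0 ≤ f x * Real.exp (b * x) :=
      mul_nonneg (hf x ⟨hx0, h2.le.trans h3⟩) (Real.exp_pos _).le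
    refine mul_lt_mul h4 (Real.exp_le_exp.mpr ?_) (Real.exp_pos _) (hfx.trans h4.le)
    exact mul_le_mul_of_nonneg_left h2.le (by linarith)
  have hlow : ∀ c, c < d → c ∉ S := fun c hc hcS => absurd (csInf_le hbdd hcS) (not_le.mpr hc)
  refine ⟨d, ?_, ?_, ?_⟩
  · refine le_of_tendsto (hτ.continuousWithinAt (s := Ioi d) (x := d)) ?_
    filter_upwards [self_mem_nhdsWithin] with c hc using (hSlt c (hup c hc)).le
  · intro x hx y hy hxy
    have hcts : ∀ t, Tendsto (fun c => f t * Real.exp (c * t)) (𝓝[>] d)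
        (𝓝 (f t * Real.exp (d * t))) := fun t =>
      ContinuousWithinAt.tendsto (Continuous.continuousWithinAt (by fun_prop))
    refine le_of_tendsto_of_tendsto (hcts x) (hcts y) ?_
    filter_upwards [self_mem_nhdsWithin,
      (hτ.continuousWithinAt (s := Ioi d) (x := d)).eventually (lt_mem_nhds hy.2)] with c hc hyc
    obtain ⟨a, b, h1, h2, h3, h4⟩ := hup c hc
    have hxI : x ∈ Icc 0 L := ⟨hx.1.le, by linarith⟩
    have hbI : b ∈ Icc 0 L := ⟨by linarith [hy.1], h3⟩
    have hyI : y ∈ Icc 0 L := ⟨hy.1.le, by linarith⟩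
    by_contra! hlt
    have q1 := hquasi c x hxI b hbI y ⟨hxy, by linarith⟩
    have q2 := hquasi c y hyI b hbI a ⟨by linarith, h2.le⟩
    rcases min_le_iff.mp q1 with q | q
    · linarith
    · rcases min_le_iff.mp q2 with q' | q' <;> linarith
  · intro x hx y hy hxy
    rcases hxy.eq_or_lt with rfl | hxy
    · rfl
    have hcts : ∀ t, Tendsto (fun c => f t * Real.exp (c * t)) (𝓝[<] d)
        (𝓝 (f t * Real.exp (d * t))) := fun t =>
      ContinuousWithinAt.tendsto (Continuous.continuousWithinAt (by fun_prop))
    refine le_of_tendsto_of_tendsto (hcts y) (hcts x) ?_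
    filter_upwards [self_mem_nhdsWithin,
      (hτ.continuousWithinAt (s := Iio d) (x := d)).eventually (gt_mem_nhds hx.1)] with c hc hxc
    by_contra! hlt
    exact hlow c hc ⟨x, y, hxc.le, hxy, hy.2.le, hlt⟩

lemma integral_inv_add_rpow {q a b : ℝ} (hq : 1 < q) (ha : 0 < a) (hb : 0 < b) :
    IntegrableOn (fun s : ℝ => (a + b * s ^ q)⁻¹) (Ioi 0) ∧
      ∫ s in Ioi (0 : ℝ), (a + b * s ^ q)⁻¹ =
        b ^ (-1 / q) * a ^ (1 / q - 1) * (Real.pi / q / Real.sin (Real.pi / q)) := by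
  have hq0 : 0 < q := by linarith
  have hq1 : 1 / q < 1 := by rw [div_lt_one hq0]; exact hq
  have hinner : ∀ t ∈ Ioi (0 : ℝ), ∫ s in Ioi (0 : ℝ),
      Real.exp (-(a * t)) * Real.exp (-(b * t) * s ^ q) =
        b ^ (-1 / q) * Real.Gamma (1 / q + 1) * (t ^ (1 - 1 / q - 1) * Real.exp (-(a * t))) := by
    intro t ht
    rw [integral_const_mul, integral_exp_neg_mul_rpow hq0 (mul_pos hb ht),
      Real.mul_rpow hb.le (le_of_lt ht), show 1 - 1 / q - 1 = -1 / q by ring]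
    ring
  have houter : ∀ s ∈ Ioi (0 : ℝ), ∫ t in Ioi (0 : ℝ),
      Real.exp (-(a * t)) * Real.exp (-(b * t) * s ^ q) = (a + b * s ^ q)⁻¹ := by
    intro s hs
    have hpos : 0 < a + b * s ^ q := by
      have := Real.rpow_pos_of_pos hs q
      positivity
    have h := Real.integral_rpow_mul_exp_neg_mul_Ioi one_pos hpos
    simp only [sub_self, Real.rpow_zero, one_mul, Real.rpow_one, Real.Gamma_one, mul_one,
      one_div] at h
    rw [← h]
    refine integral_congr_ae (Eventually.of_forall fun t => ?_)
    simp only [← Real.exp_add]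
    congr 1
    ring
  have hrpow := Real.continuous_rpow_const hq0.le
  have hint : Integrable (Function.uncurry fun s t : ℝ =>
      Real.exp (-(a * t)) * Real.exp (-(b * t) * s ^ q))
      ((volume.restrict (Ioi 0)).prod (volume.restrict (Ioi 0))) := by
    rw [integrable_prod_iff']
    · constructor
      · refine (ae_restrict_iff' measurableSet_Ioi).mpr (Eventually.of_forall fun t ht => ?_)
        have := integrableOn_rpow_mul_exp_neg_mul_rpow (s := 0) (by norm_num) hq0 (mul_pos hb ht)
        simp only [Real.rpow_zero, one_mul] at this
        exact (this.const_mul (Real.exp (-(a * t))) :)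
      · have h1 := integrableOn_rpow_mul_exp_neg_mul_rpow (s := 1 - 1 / q - 1) (p := 1) (b := a)
          (by linarith) one_pos ha
        simp only [Real.rpow_one, neg_mul] at h1
        refine (h1.const_mul (b ^ (-1 / q) * Real.Gamma (1 / q + 1))).congr ?_
        refine (ae_restrict_iff' measurableSet_Ioi).mpr (Eventually.of_forall fun t ht => ?_)
        simp only [Function.uncurry]
        rw [← hinner t ht]
        refine integral_congr_ae (Eventually.of_forall fun s => ?_)
        simp only
        rw [Real.norm_of_nonneg (by positivity)]
    · refine Continuous.aestronglyMeasurable ?_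
      simp only [Function.uncurry_def]
      fun_prop
  have h1 := hint.integral_prod_left
  have h2 := integral_integral_swap hint
  rw [setIntegral_congr_fun measurableSet_Ioi houter,
    setIntegral_congr_fun measurableSet_Ioi hinner, integral_const_mul,
    Real.integral_rpow_mul_exp_neg_mul_Ioi (by linarith) ha] at h2
  constructor
  · refine IntegrableOn.congr_fun (f := fun s => ∫ t in Ioi (0 : ℝ),
      Real.exp (-(a * t)) * Real.exp (-(b * t) * s ^ q)) h1 houter measurableSet_Ioi
  · have h3 := Real.Gamma_mul_Gamma_one_sub (1 / q)
    rw [h2, Real.Gamma_add_one (by positivity), one_div a, Real.inv_rpow ha.le,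
      ← Real.rpow_neg ha.le, neg_sub]
    rw [mul_one_div] at h3
    calc _ = b ^ (-1 / q) * a ^ (1 / q - 1) *
        (1 / q * (Real.Gamma (1 / q) * Real.Gamma (1 - 1 / q))) := by ring
      _ = _ := by rw [h3]; ring

lemma pi_p_pos {p : ℝ} (hp : 1 < p) : 0 < pi_p p := by
  have h1 : 0 < Real.sin (Real.pi / p) :=
    Real.sin_pos_of_pos_of_lt_pi (by positivity) (div_lt_self Real.pi_pos hp)
  have h2 : 0 < (p - 1) ^ (1 / p) := Real.rpow_pos_of_pos (by linarith) _
  have := Real.pi_pos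
  unfold pi_p
  positivity

lemma two_mul_integral_eq_pi_p {p lam : ℝ} (hp : 1 < p) (hlam : 0 < lam) :
    2 * ∫ s in Ioi (0 : ℝ), (lam + (p - 1) * s ^ p.conjExponent)⁻¹ =
      pi_p p / lam ^ (1 / p) := by
  have hpq := Real.HolderConjugate.conjExponent hp
  have hp1 : 0 < p - 1 := by linarith
  have e1 : 1 / p.conjExponent = 1 - 1 / p := by
    have := hpq.inv_add_inv_eq_one
    simp only [one_div]
    linarith
  have e2 : Real.pi / p.conjExponent = Real.pi * (1 - 1 / p) := by rw [← e1, mul_one_div]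
  have e3 : Real.sin (Real.pi * (1 - 1 / p)) = Real.sin (Real.pi / p) := by
    rw [← Real.sin_pi_sub]
    congr 1
    ring
  rw [(integral_inv_add_rpow hpq.symm.lt hlam hp1).2, neg_div, e2, e1, e3, neg_sub,
    Real.rpow_sub_one hp1.ne', show 1 - 1 / p - 1 = -(1 / p) by ring, Real.rpow_neg hlam.le, pi_p]
  have h1 : Real.sin (Real.pi / p) ≠ 0 :=
    (Real.sin_pos_of_pos_of_lt_pi (by positivity) (div_lt_self Real.pi_pos hp)).ne'
  have h2 := (Real.rpow_pos_of_pos hlam (1 / p)).ne'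
  field_simp

lemma exists_lt_two_mul_integral {p lam L : ℝ} (hp : 1 < p) (hlam : 0 < lam) (hL : 0 < L)
    (hlt : lam < (pi_p p / L) ^ p) :
    ∃ R, 0 ≤ R ∧ L < 2 * ∫ s in (0 : ℝ)..R, (lam + (p - 1) * s ^ p.conjExponent)⁻¹ := by
  have hpq := Real.HolderConjugate.conjExponent hp
  have h1 : L < pi_p p / lam ^ (1 / p) := by
    have h2 : lam ^ (1 / p) < pi_p p / L := by
      rw [one_div]
      exact (Real.rpow_inv_lt_iff_of_pos hlam.le (div_pos (pi_p_pos hp) hL).le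
        (by linarith)).mpr hlt
    rw [lt_div_iff₀ hL] at h2
    rw [lt_div_iff₀ (Real.rpow_pos_of_pos hlam _)]
    linarith
  rw [← two_mul_integral_eq_pi_p hp hlam] at h1
  have h2 := (intervalIntegral_tendsto_integral_Ioi 0
    (integral_inv_add_rpow hpq.symm.lt hlam (by linarith : 0 < p - 1)).1 tendsto_id).const_mul 2
  obtain ⟨R, hR, hR0⟩ := ((h2.eventually (lt_mem_nhds h1)).and (eventually_ge_atTop 0)).exists
  exact ⟨R, hR0, hR⟩

/-- Log-concave functions are unimodal after any exponential tilt. -/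
lemma min_le_of_logconcave {f : ℝ → ℝ} {L : ℝ} (hf : ∀ x ∈ Icc (0 : ℝ) L, 0 ≤ f x)
    (hlc : ∀ x ∈ Icc (0 : ℝ) L, ∀ y ∈ Icc (0 : ℝ) L, ∀ t ∈ Icc (0 : ℝ) 1,
      f (t * x + (1 - t) * y) ≥ f x ^ t * f y ^ (1 - t)) (c : ℝ) {x y z : ℝ}
    (hx : x ∈ Icc 0 L) (hy : y ∈ Icc 0 L) (hz : z ∈ Icc x y) :
    min (f x * Real.exp (c * x)) (f y * Real.exp (c * y)) ≤ f z * Real.exp (c * z) := by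
  obtain ⟨a, b, ha, hb, hab, rfl⟩ : ∃ a b : ℝ, 0 ≤ a ∧ 0 ≤ b ∧ a + b = 1 ∧ a * x + b * y = z := by
    have := segment_eq_Icc (hz.1.trans hz.2) ▸ hz
    simpa [segment] using this
  obtain rfl : b = 1 - a := by linarith
  set X := f x * Real.exp (c * x) with hX
  set Y := f y * Real.exp (c * y) with hY
  have hX0 : 0 ≤ X := mul_nonneg (hf x hx) (Real.exp_pos _).le
  have hY0 : 0 ≤ Y := mul_nonneg (hf y hy) (Real.exp_pos _).le
  have hM : 0 ≤ min X Y := le_min hX0 hY0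
  calc min X Y = min X Y ^ a * min X Y ^ (1 - a) := by
        rw [← Real.rpow_add_of_nonneg hM ha hb, hab, Real.rpow_one]
    _ ≤ X ^ a * Y ^ (1 - a) := mul_le_mul (Real.rpow_le_rpow hM (min_le_left _ _) ha)
        (Real.rpow_le_rpow hM (min_le_right _ _) hb) (Real.rpow_nonneg hM _)
        (Real.rpow_nonneg hX0 _)
    _ = f x ^ a * f y ^ (1 - a) * Real.exp (c * (a * x + (1 - a) * y)) := by
        rw [hX, hY, Real.mul_rpow (hf x hx) (Real.exp_pos _).le,
          Real.mul_rpow (hf y hy) (Real.exp_pos _).le, ← Real.exp_mul, ← Real.exp_mul,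
          show c * (a * x + (1 - a) * y) = c * x * a + c * y * (1 - a) by ring, Real.exp_add]
        ring
    _ ≤ _ := by
        gcongr
        exact hlc x hx y hy a ⟨ha, by linarith⟩

lemma exists_bound_of_unimodal {f : ℝ → ℝ} {L : ℝ}
    (hquasi : ∀ c, ∀ x ∈ Icc 0 L, ∀ y ∈ Icc 0 L, ∀ z ∈ Icc x y,
      min (f x * Real.exp (c * x)) (f y * Real.exp (c * y)) ≤ f z * Real.exp (c * z))
    {a b : ℝ} (ha : a ∈ Icc 0 L) (hb : b ∈ Icc 0 L) (hab : a < b) (hfa : 0 < f a)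
    (hfb : 0 < f b) : ∃ B, ∀ x ∈ Icc 0 L, f x ≤ B := by
  have tilt : ∀ x y : ℝ, x ≠ y → 0 < f y →
      ∃ c, f x * Real.exp (c * x) < f y * Real.exp (c * y) := by
    intro x y hxy hy
    have hne : y - x ≠ 0 := sub_ne_zero.mpr hxy.symm
    refine ⟨f x / f y / (y - x), ?_⟩
    have h := Real.add_one_le_exp (f x / f y)
    have h1 : f x / f y < Real.exp (f x / f y / (y - x) * y - f x / f y / (y - x) * x) := by
      rw [← mul_sub, div_mul_cancel₀ _ hne]
      linarith
    rw [Real.exp_sub, div_lt_div_iff₀ hy (Real.exp_pos _)] at h1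
    linarith
  obtain ⟨e, hae, heb⟩ := exists_between hab
  have he : e ∈ Icc 0 L := ⟨ha.1.trans hae.le, heb.le.trans hb.2⟩
  have hfe : 0 < f e := by
    have := hquasi 0 a ha b hb e ⟨hae.le, heb.le⟩
    simp only [zero_mul, Real.exp_zero, mul_one] at this
    exact (lt_min hfa hfb).trans_le this
  obtain ⟨c, hc⟩ := tilt e b heb.ne hfb
  obtain ⟨d, hd⟩ := tilt e a hae.ne' hfa
  have bound : ∀ c x, x ∈ Icc 0 L → f x * Real.exp (c * x) ≤ f e * Real.exp (c * e) →
      f x ≤ f e * Real.exp (|c| * L) := by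
    intro c x hx h
    have h1 : c * (e - x) ≤ |c| * L := by
      have h2 : |e - x| ≤ L := abs_le.mpr ⟨by linarith [hx.2, he.1], by linarith [hx.1, he.2]⟩
      calc c * (e - x) ≤ |c * (e - x)| := le_abs_self _
        _ = |c| * |e - x| := abs_mul _ _
        _ ≤ |c| * L := by gcongr
    have h2 : f x ≤ f e * Real.exp (c * (e - x)) := by
      rw [mul_sub, Real.exp_sub, ← mul_div_assoc, le_div_iff₀ (Real.exp_pos _)]
      exact h
    exact h2.trans (by gcongr)
  refine ⟨max (f e * Real.exp (|c| * L)) (f e * Real.exp (|d| * L)), fun x hx => ?_⟩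
  rcases le_total x e with hxe | hxe
  · refine le_max_of_le_left (bound c x hx ?_)
    rcases min_le_iff.mp (hquasi c x hx b hb e ⟨hxe, heb.le⟩) with h | h <;> linarith
  · refine le_max_of_le_right (bound d x hx ?_)
    rcases min_le_iff.mp (hquasi d a ha x hx e ⟨hae.le, hxe⟩) with h | h <;> linarith

lemma integrableOn_of_unimodal {f : ℝ → ℝ} {L B : ℝ} (hf : ∀ x ∈ Icc 0 L, 0 ≤ f x)
    (hB : ∀ x ∈ Icc 0 L, f x ≤ B)
    (hquasi : ∀ x ∈ Icc 0 L, ∀ y ∈ Icc 0 L, ∀ z ∈ Icc x y, min (f x) (f y) ≤ f z) :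
    IntegrableOn f (Icc 0 L) := by
  have hmeas : Measurable ((Icc 0 L).indicator f) := by
    refine measurable_of_Ioi fun t => ?_
    rcases lt_or_ge t 0 with ht | ht
    · convert MeasurableSet.univ
      refine eq_univ_of_forall fun x => ?_
      exact ht.trans_le (indicator_nonneg hf x)
    · have hmem : ∀ x, x ∈ (Icc 0 L).indicator f ⁻¹' Ioi t ↔ x ∈ Icc 0 L ∧ t < f x := by
        intro x
        by_cases hx : x ∈ Icc 0 L
        · simp only [mem_preimage, mem_Ioi, indicator_of_mem hx, hx, true_and]
        · simp only [mem_preimage, mem_Ioi, indicator_of_notMem hx, hx, false_and, iff_false]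
          exact not_lt.mpr ht
      refine OrdConnected.measurableSet ⟨fun x hx y hy z hz => ?_⟩
      rw [hmem] at hx hy ⊢
      exact ⟨⟨hx.1.1.trans hz.1, hz.2.trans hy.1.2⟩,
        (lt_min hx.2 hy.2).trans_le (hquasi x hx.1 y hy.1 z hz)⟩
  refine Integrable.of_bound (C := B)
    ((aemeasurable_indicator_iff measurableSet_Icc).mp hmeas.aemeasurable).aestronglyMeasurable ?_
  refine (ae_restrict_iff' measurableSet_Icc).mpr (Eventually.of_forall fun x hx => ?_)
  rw [Real.norm_of_nonneg (hf x hx)]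
  exact hB x hx

lemma exists_pos_pair_of_integral_pos {f g : ℝ → ℝ} {L : ℝ} (hf : ∀ x ∈ Icc 0 L, 0 ≤ f x)
    (hpos : 0 < ∫ x in Icc (0 : ℝ) L, f x * g x) :
    ∃ a ∈ Icc 0 L, ∃ b ∈ Icc 0 L, a < b ∧ 0 < f a ∧ 0 < f b := by
  by_contra! hcon
  have hsub : {x | x ∈ Icc 0 L ∧ 0 < f x}.Subsingleton := by
    intro x hx y hy
    rcases lt_trichotomy x y with h | h | h
    · exact absurd hy.2 (not_lt.mpr (hcon x hx.1 y hy.1 h hx.2))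
    · exact h
    · exact absurd hx.2 (not_lt.mpr (hcon y hy.1 x hx.1 h hy.2))
  refine hpos.ne' (integral_eq_zero_of_ae ?_)
  refine (ae_restrict_iff' measurableSet_Icc).mpr ?_
  have h0 : ∀ᵐ x ∂(volume : Measure ℝ), x ∉ {x | x ∈ Icc 0 L ∧ 0 < f x} :=
    measure_eq_zero_iff_ae_notMem.mp (hsub.measure_zero _)
  filter_upwards [h0] with x hx hxI
  have : f x = 0 := le_antisymm (not_lt.mp fun h => hx ⟨hxI, h⟩) (hf x hxI)
  simp [this]

/-- The inequality for constants below the sharp one, with the second integrand centred at a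
suitable value of `u`. -/
lemma exists_center_integral_nonneg {p L lam B : ℝ} (hp : 1 < p) (hL : 0 < L) (hlam : 0 < lam)
    (hlt : lam < (pi_p p / L) ^ p) {f u u' : ℝ → ℝ} (hf : ∀ x ∈ Icc 0 L, 0 ≤ f x)
    (hB : ∀ x ∈ Icc 0 L, f x ≤ B)
    (hquasi : ∀ c, ∀ x ∈ Icc 0 L, ∀ y ∈ Icc 0 L, ∀ z ∈ Icc x y,
      min (f x * Real.exp (c * x)) (f y * Real.exp (c * y)) ≤ f z * Real.exp (c * z))
    (hpos : ∃ y ∈ Ioc 0 L, 0 < f y) (hfint : IntegrableOn f (Icc 0 L))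
    (hu : ContinuousOn u (Icc 0 L)) (hu' : ContinuousOn u' (Icc 0 L))
    (hd : ∀ x ∈ Ioo 0 L, HasDerivAt u (u' x) x) :
    ∃ a, 0 ≤ ∫ x in Icc (0 : ℝ) L, f x * (|u' x| ^ p - lam * |u x - a| ^ p) := by
  have hp0 : 0 ≤ p := by linarith
  obtain ⟨R, hR, hRL⟩ := exists_lt_two_mul_integral hp hlam hL hlt
  have hsum := two_mul_integral_le_riccatiTime hp hlam hR
  have htop := tendsto_riccatiTime_atTop hp hlam hR
  have hτL : ∃ c, L < riccatiTime p lam R (-c) := by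
    obtain ⟨c, hc⟩ := (htop.eventually (gt_mem_nhds (sub_pos.mpr hRL))).exists
    refine ⟨-c, ?_⟩
    have := hsum c
    rw [neg_neg]
    linarith
  obtain ⟨c, hmL, hmono, hanti⟩ := exists_tilt_peak hf hquasi hpos
    ((continuous_riccatiTime hp hlam R).comp continuous_neg)
    (fun a b hab => monotone_riccatiTime hp hlam hR (neg_le_neg hab))
    (fun c => riccatiTime_nonneg hlam hR (-c)) htop hτL
  simp only [Function.comp_apply] at hmL hmono hanti
  set m := riccatiTime p lam R (-c) with hm
  have hm0 : 0 ≤ m := riccatiTime_nonneg hlam hR (-c)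
  set G : ℝ → ℝ := fun x => f x * (|u' x| ^ p - lam * |u x - u m| ^ p) with hG
  have hGint : IntegrableOn G (Icc 0 L) := by
    refine hfint.mul_continuousOn (ContinuousOn.sub ?_ (ContinuousOn.mul (by fun_prop) ?_))
      isCompact_Icc
    · exact hu'.abs.rpow_const fun x _ => Or.inr hp0
    · exact (hu.sub continuousOn_const).abs.rpow_const fun x _ => Or.inr hp0
  have hGi : ∀ a b, a ∈ Icc 0 L → b ∈ Icc 0 L → IntervalIntegrable G volume a b :=
    fun a b ha hb => (hGint.mono_set (uIcc_subset_Icc ha hb)).intervalIntegrable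
  have hL0 : (0 : ℝ) ∈ Icc 0 L := ⟨le_rfl, hL.le⟩
  have hmI : m ∈ Icc 0 L := ⟨hm0, hmL⟩
  refine ⟨u m, ?_⟩
  rw [integral_Icc_eq_integral_Ioc, ← intervalIntegral.integral_of_le hL.le,
    ← intervalIntegral.integral_add_adjacent_intervals (hGi 0 m hL0 hmI)
      (hGi m L hmI ⟨hL.le, le_rfl⟩)]
  refine add_nonneg ?_ ?_
  · have h := integral_decreasing_weight_nonneg (R := R) (c := -c) (l := m) (B := B)
      (k := fun x => f (m - x)) (v := fun x => u (m - x) - u m) (v' := fun x => -u' (m - x))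
      hp hlam hR hm0 le_rfl ?_ ?_ ?_ ?_ ?_ ?_ (by simp)
    · have e := intervalIntegral.integral_comp_sub_left (a := 0) (b := m) G m
      rw [sub_self, sub_zero] at e
      rw [← e]
      simpa only [hG, abs_neg] using h
    · intro x hx y hy hxy
      have h1 := hmono (a := m - y) ⟨by linarith [hy.2], by linarith [hy.1]⟩
        (b := m - x) ⟨by linarith [hx.2], by linarith [hx.1]⟩ (by linarith)
      have e : ∀ t, Real.exp (-c * t) = Real.exp (c * (m - t)) * Real.exp (-(c * m)) := fun t => by
        rw [← Real.exp_add]; ring_nf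
      simp only [e, ← mul_assoc]
      exact mul_le_mul_of_nonneg_right h1 (Real.exp_pos _).le
    · exact fun x hx => hf _ ⟨by linarith [hx.2], by linarith [hx.1]⟩
    · exact fun x hx => hB _ ⟨by linarith [hx.2], by linarith [hx.1]⟩
    · refine ContinuousOn.sub (hu.comp (by fun_prop) fun x hx => ?_) continuousOn_const
      exact ⟨by linarith [hx.2], by linarith [hx.1]⟩
    · refine ContinuousOn.neg (hu'.comp (by fun_prop) fun x hx => ?_)
      exact ⟨by linarith [hx.2], by linarith [hx.1]⟩
    · intro x hx
      have h1 := hd (m - x) ⟨by linarith [hx.2], by linarith [hx.1]⟩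
      simpa using ((h1.comp_const_sub m x).sub_const (u m))
  · have hlm : L - m ≤ riccatiTime p lam R c := by linarith [hsum c]
    have h := integral_decreasing_weight_nonneg (R := R) (c := c) (l := L - m) (B := B)
      (k := fun x => f (m + x)) (v := fun x => u (m + x) - u m) (v' := fun x => u' (m + x))
      hp hlam hR (by linarith) hlm ?_ ?_ ?_ ?_ ?_ ?_ (by simp)
    · have e := intervalIntegral.integral_comp_add_left (a := 0) (b := L - m) G m
      rw [add_zero, add_sub_cancel] at e
      rw [← e]
      exact h
    · intro x hx y hy hxy
      have h1 := hanti (a := m + x) ⟨by linarith [hx.1], by linarith [hx.2]⟩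
        (b := m + y) ⟨by linarith [hy.1], by linarith [hy.2]⟩ (by linarith)
      have e : ∀ t, Real.exp (c * t) = Real.exp (c * (m + t)) * Real.exp (-(c * m)) := fun t => by
        rw [← Real.exp_add]; ring_nf
      simp only [e x, e y, ← mul_assoc]
      exact mul_le_mul_of_nonneg_right h1 (Real.exp_pos _).le
    · exact fun x hx => hf _ ⟨by linarith [hx.1], by linarith [hx.2]⟩
    · exact fun x hx => hB _ ⟨by linarith [hx.1], by linarith [hx.2]⟩
    · refine ContinuousOn.sub (hu.comp (by fun_prop) fun x hx => ?_) continuousOn_const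
      exact ⟨by linarith [hx.1], by linarith [hx.2]⟩
    · refine hu'.comp (by fun_prop) fun x hx => ?_
      exact ⟨by linarith [hx.1], by linarith [hx.2]⟩
    · intro x hx
      have h1 := hd (m + x) ⟨by linarith [hx.1], by linarith [hx.2]⟩
      simpa using ((h1.comp_const_add m x).sub_const (u m))

/-- Among all shifts of `u`, the one with vanishing weighted `p`-mean minimises the weighted
`p`-norm. -/
lemma integral_abs_rpow_le_integral_abs_sub_rpow {p L : ℝ} (hp : 2 ≤ p) {f u : ℝ → ℝ}
    (hf : ∀ x ∈ Icc 0 L, 0 ≤ f x) (hfint : IntegrableOn f (Icc 0 L))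
    (hu : ContinuousOn u (Icc 0 L))
    (hmean : ∫ x in Icc (0 : ℝ) L, f x * (|u x| ^ (p - 2) * u x) = 0) (a : ℝ) :
    ∫ x in Icc (0 : ℝ) L, f x * |u x| ^ p ≤ ∫ x in Icc (0 : ℝ) L, f x * |u x - a| ^ p := by
  have hp0 : 0 ≤ p := by linarith
  have hp2 : 0 ≤ p - 2 := by linarith
  have i1 : IntegrableOn (fun x => f x * |u x| ^ p) (Icc 0 L) :=
    hfint.mul_continuousOn (hu.abs.rpow_const fun x _ => Or.inr hp0) isCompact_Icc
  have i2 : IntegrableOn (fun x => f x * (|u x| ^ (p - 2) * u x)) (Icc 0 L) :=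
    hfint.mul_continuousOn ((hu.abs.rpow_const fun x _ => Or.inr hp2).mul hu) isCompact_Icc
  have i3 : IntegrableOn (fun x => f x * |u x - a| ^ p) (Icc 0 L) :=
    hfint.mul_continuousOn ((hu.sub continuousOn_const).abs.rpow_const fun x _ => Or.inr hp0)
      isCompact_Icc
  calc ∫ x in Icc (0 : ℝ) L, f x * |u x| ^ p
      = ∫ x in Icc (0 : ℝ) L, (f x * |u x| ^ p - p * a * (f x * (|u x| ^ (p - 2) * u x))) := by
        rw [integral_sub i1 (i2.const_mul _), integral_const_mul, hmean, mul_zero, sub_zero]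
    _ ≤ _ := by
        refine setIntegral_mono_on (i1.sub (i2.const_mul _)) i3 measurableSet_Icc fun x hx => ?_
        have := mul_le_mul_of_nonneg_left
          (abs_rpow_tangent_le (by linarith : 1 < p) (u x) a) (hf x hx)
        linarith

/-- **Proposition 1.1 (sharp weighted Wirtinger inequality).**
Let `p ≥ 2`, `L > 0` and let `f` be a nonnegative log-concave weight on `[0, L]`.
Every `C¹` function `u` on `[0, L]` with `∫₀^L f |u|^(p-2) u = 0` and `∫₀^L f |u|^p > 0`
satisfies `∫₀^L f |u'|^p ≥ (π_p/L)^p ∫₀^L f |u|^p`. -/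
theorem weighted_wirtinger_logconcave
    (p L : ℝ) (hp : 2 ≤ p) (hL : 0 < L)
    (f : ℝ → ℝ)
    (hf_nonneg : ∀ x ∈ Set.Icc (0:ℝ) L, 0 ≤ f x)
    (hf_logconc : ∀ x ∈ Set.Icc (0:ℝ) L, ∀ y ∈ Set.Icc (0:ℝ) L, ∀ t ∈ Set.Icc (0:ℝ) 1,
      f (t * x + (1 - t) * y) ≥ f x ^ t * f y ^ (1 - t))
    (u : ℝ → ℝ) (hu : ContDiffOn ℝ 1 u (Set.Icc 0 L))
    (hmean : ∫ x in Set.Icc (0:ℝ) L, f x * (|u x| ^ (p - 2) * u x) = 0)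
    (hpos : 0 < ∫ x in Set.Icc (0:ℝ) L, f x * |u x| ^ p) :
    ∫ x in Set.Icc (0:ℝ) L, f x * |derivWithin u (Set.Icc 0 L) x| ^ p ≥
      (pi_p p / L) ^ p * ∫ x in Set.Icc (0:ℝ) L, f x * |u x| ^ p := by
  have hp1 : 1 < p := by linarith
  have hp0 : 0 ≤ p := by linarith
  have hquasi : ∀ c, ∀ x ∈ Icc 0 L, ∀ y ∈ Icc 0 L, ∀ z ∈ Icc x y,
      min (f x * Real.exp (c * x)) (f y * Real.exp (c * y)) ≤ f z * Real.exp (c * z) :=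
    fun c x hx y hy z hz => min_le_of_logconcave hf_nonneg hf_logconc c hx hy hz
  obtain ⟨a, ha, b, hb, hab, hfa, hfb⟩ := exists_pos_pair_of_integral_pos hf_nonneg hpos
  obtain ⟨B, hB⟩ := exists_bound_of_unimodal hquasi ha hb hab hfa hfb
  have hfint : IntegrableOn f (Icc 0 L) := integrableOn_of_unimodal hf_nonneg hB
    fun x hx y hy z hz => by simpa using hquasi 0 x hx y hy z hz
  have hu' : ContinuousOn (derivWithin u (Icc 0 L)) (Icc 0 L) :=
    hu.continuousOn_derivWithin (uniqueDiffOn_Icc hL) le_rfl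
  have hd : ∀ x ∈ Ioo 0 L, HasDerivAt u (derivWithin u (Icc 0 L) x) x := fun x hx =>
    ((hu.differentiableOn one_ne_zero) x (Ioo_subset_Icc_self hx)).hasDerivWithinAt.hasDerivAt
      (Icc_mem_nhds hx.1 hx.2)
  rw [ge_iff_le, ← le_div_iff₀ hpos]
  refine le_of_forall_lt_imp_le_of_dense fun lam hlt => ?_
  rcases le_or_gt lam 0 with hlam | hlam
  · refine hlam.trans (div_nonneg ?_ hpos.le)
    exact setIntegral_nonneg measurableSet_Icc fun x hx =>
      mul_nonneg (hf_nonneg x hx) (Real.rpow_nonneg (abs_nonneg _) _)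
  rw [le_div_iff₀ hpos]
  obtain ⟨c, hc⟩ := exists_center_integral_nonneg hp1 hL hlam hlt hf_nonneg hB hquasi
    ⟨b, ⟨ha.1.trans_lt hab, hb.2⟩, hfb⟩ hfint hu.continuousOn hu' hd
  have hcmp := mul_le_mul_of_nonneg_left
    (integral_abs_rpow_le_integral_abs_sub_rpow hp hf_nonneg hfint hu.continuousOn hmean c) hlam.le
  refine hcmp.trans ?_
  have i1 : IntegrableOn (fun x => f x * |derivWithin u (Icc 0 L) x| ^ p) (Icc 0 L) :=
    hfint.mul_continuousOn (hu'.abs.rpow_const fun x _ => Or.inr hp0) isCompact_Icc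
  have i2 : IntegrableOn (fun x => f x * |u x - c| ^ p) (Icc 0 L) :=
    hfint.mul_continuousOn
      ((hu.continuousOn.sub continuousOn_const).abs.rpow_const fun x _ => Or.inr hp0)
      isCompact_Icc
  rw [← integral_const_mul, ← sub_nonneg, ← integral_sub i1 (i2.const_mul lam)]
  refine hc.trans_eq (integral_congr_ae (Eventually.of_forall fun x => ?_))
  simp only
  ring
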